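/- The fixed subspace of the map induced by c on Sym²V (the symmetric tensors in V ⊗ V) has dimension (n−1)/2 if n is odd and n/2 if n is even, and the fixed subspace of the map induced by c on Λ²V (the antisymmetric tensors in V ⊗ V) has dimension (n−1)/2 if n is odd and n/2 − 1 if n is even. -/

import Mathlib

open scoped BigOperators TensorProduct

set_option synthInstance.maxHeartbeats 1000000
set_option maxHeartbeats 1000000

noncomputable section

/-- The sum-zero hyperplane `V = {x ∈ ℂ^n : x₁ + ⋯ + x_n = 0}`. -/
def sumZero (n : ℕ) : Submodule ℂ (Fin n → ℂ) where
  carrier := {x | ∑ i, x i = 0}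
  add_mem' := by
    intro a b ha hb
    simp only [Set.mem_setOf_eq, Pi.add_apply, Finset.sum_add_distrib] at *
    simp [ha, hb]
  zero_mem' := by simp
  smul_mem' := by
    intro c x hx
    simp only [Set.mem_setOf_eq, Pi.smul_apply, smul_eq_mul, ← Finset.mul_sum] at *
    simp [hx]

lemma mem_sumZero {n : ℕ} {x : Fin n → ℂ} : x ∈ sumZero n ↔ ∑ i, x i = 0 := Iff.rfl

/-- The cyclic coordinate shift `(c·x)_i = x_{i−1 mod n}` on `ℂ^n`. -/
def shiftL (n : ℕ) [NeZero n] : (Fin n → ℂ) →ₗ[ℂ] (Fin n → ℂ) where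
  toFun x := fun i => x (i - 1)
  map_add' _ _ := rfl
  map_smul' _ _ := rfl

lemma shiftL_mem_sumZero (n : ℕ) [NeZero n] (x : Fin n → ℂ) (hx : x ∈ sumZero n) :
    shiftL n x ∈ sumZero n := by
  rw [mem_sumZero] at hx ⊢
  calc ∑ i, (shiftL n) x i = ∑ i, x i :=
        Fintype.sum_equiv (Equiv.subRight (1 : Fin n)) _ _ (fun i => rfl)
    _ = 0 := hx

/-- The cyclic shift restricted to the sum-zero hyperplane. -/
def cV (n : ℕ) [NeZero n] : (sumZero n) →ₗ[ℂ] (sumZero n) :=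
  (shiftL n).restrict (fun x hx => shiftL_mem_sumZero n x hx)

/-- Shortcut instances to keep typeclass search on the tensor square manageable. -/
instance (n : ℕ) : AddCommGroup ((sumZero n) ⊗[ℂ] (sumZero n)) := inferInstance

instance (n : ℕ) : Module ℂ ((sumZero n) ⊗[ℂ] (sumZero n)) := inferInstance

/-- The map induced by the cyclic shift on `V ⊗ V`. -/
def cTensor (n : ℕ) [NeZero n] :
    ((sumZero n) ⊗[ℂ] (sumZero n)) →ₗ[ℂ] ((sumZero n) ⊗[ℂ] (sumZero n)) :=
  TensorProduct.map (cV n) (cV n)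

/-- The swap (braiding) `v ⊗ w ↦ w ⊗ v` on `V ⊗ V` as a linear map. -/
def swapMap (n : ℕ) :
    ((sumZero n) ⊗[ℂ] (sumZero n)) →ₗ[ℂ] ((sumZero n) ⊗[ℂ] (sumZero n)) :=
  (TensorProduct.comm ℂ (sumZero n) (sumZero n)).toLinearMap

/-- `Sym² V`: the symmetric tensors in `V ⊗ V` (fixed by the swap). -/
def symTwo (n : ℕ) : Submodule ℂ ((sumZero n) ⊗[ℂ] (sumZero n)) :=
  LinearMap.ker (swapMap n - LinearMap.id)

/-- `Λ² V`: the antisymmetric tensors in `V ⊗ V` (negated by the swap). -/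
def altTwo (n : ℕ) : Submodule ℂ ((sumZero n) ⊗[ℂ] (sumZero n)) :=
  LinearMap.ker (swapMap n + LinearMap.id)

/-- The subspace of `V ⊗ V` fixed by the map induced by the cyclic shift. -/
def shiftFixed (n : ℕ) [NeZero n] : Submodule ℂ ((sumZero n) ⊗[ℂ] (sumZero n)) :=
  LinearMap.ker (cTensor n - LinearMap.id)

/-- The `(i, j)` matrix entry of a tensor in `V ⊗ V`. -/
def tensorCoord (n : ℕ) (i j : Fin n) : ((sumZero n) ⊗[ℂ] (sumZero n)) →ₗ[ℂ] ℂ :=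
  (TensorProduct.lid ℂ ℂ).toLinearMap ∘ₗ
    TensorProduct.map (LinearMap.proj i ∘ₗ (sumZero n).subtype)
      (LinearMap.proj j ∘ₗ (sumZero n).subtype)

@[simp]
lemma tensorCoord_tmul {n : ℕ} (i j : Fin n) (x y : sumZero n) :
    tensorCoord n i j (x ⊗ₜ y) = x.1 i * y.1 j := by
  simp [tensorCoord]

/-- The projection of the `i`-th standard basis vector to the sum-zero hyperplane. -/
def projBasis (n : ℕ) [NeZero n] (i : Fin n) : sumZero n :=
  ⟨fun k => (if k = i then 1 else 0) - (n : ℂ)⁻¹, by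
    have : (n : ℂ) ≠ 0 := Nat.cast_ne_zero.mpr (NeZero.ne n)
    simp [mem_sumZero, Finset.sum_sub_distrib, this]⟩

lemma sum_smul_projBasis {n : ℕ} [NeZero n] (x : sumZero n) :
    ∑ i, x.1 i • projBasis n i = x := by
  ext k
  have h := mem_sumZero.mp x.2
  simp [projBasis, mul_sub, Finset.sum_sub_distrib, ← Finset.sum_mul, h]

lemma sum_tensorCoord_smul {n : ℕ} [NeZero n] (t : (sumZero n) ⊗[ℂ] (sumZero n)) :
    ∑ i, ∑ j, tensorCoord n i j t • (projBasis n i ⊗ₜ[ℂ] projBasis n j) = t := by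
  induction t with
  | zero => simp
  | add a b ha hb =>
    simp only [map_add, add_smul, Finset.sum_add_distrib, ha, hb]
  | tmul x y =>
    conv_rhs => rw [← sum_smul_projBasis x, ← sum_smul_projBasis y]
    simp only [TensorProduct.sum_tmul, TensorProduct.tmul_sum, TensorProduct.smul_tmul_smul,
      tensorCoord_tmul]
    exact Finset.sum_comm

lemma tensor_ext {n : ℕ} [NeZero n] {s t : (sumZero n) ⊗[ℂ] (sumZero n)}
    (h : ∀ i j, tensorCoord n i j s = tensorCoord n i j t) : s = t := by
  rw [← sum_tensorCoord_smul s, ← sum_tensorCoord_smul t]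
  simp only [h]

lemma tensorCoord_cTensor {n : ℕ} [NeZero n] (i j : Fin n)
    (t : (sumZero n) ⊗[ℂ] (sumZero n)) :
    tensorCoord n i j (cTensor n t) = tensorCoord n (i - 1) (j - 1) t := by
  induction t with
  | zero => simp
  | add a b ha hb => simp only [map_add, ha, hb]
  | tmul x y =>
    simp only [cTensor, TensorProduct.map_tmul, tensorCoord_tmul]
    rfl

lemma tensorCoord_swapMap {n : ℕ} (i j : Fin n) (t : (sumZero n) ⊗[ℂ] (sumZero n)) :
    tensorCoord n i j (swapMap n t) = tensorCoord n j i t := by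
  induction t with
  | zero => simp
  | add a b ha hb => simp only [map_add, ha, hb]
  | tmul x y => simp [swapMap, mul_comm]

lemma sum_tensorCoord {n : ℕ} (i : Fin n) (t : (sumZero n) ⊗[ℂ] (sumZero n)) :
    ∑ j, tensorCoord n i j t = 0 := by
  induction t with
  | zero => simp
  | add a b ha hb => simp only [map_add, Finset.sum_add_distrib, ha, hb, add_zero]
  | tmul x y => simp [← Finset.mul_sum, mem_sumZero.mp y.2]

lemma mem_shiftFixed {n : ℕ} [NeZero n] {t : (sumZero n) ⊗[ℂ] (sumZero n)} :
    t ∈ shiftFixed n ↔ ∀ i j, tensorCoord n (i - 1) (j - 1) t = tensorCoord n i j t := by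
  rw [shiftFixed, LinearMap.mem_ker, LinearMap.sub_apply, sub_eq_zero]
  refine ⟨fun h i j => ?_, fun h => tensor_ext fun i j => ?_⟩
  · rw [← tensorCoord_cTensor, h, LinearMap.id_apply]
  · rw [tensorCoord_cTensor, h, LinearMap.id_apply]

lemma tensorCoord_of_mem_shiftFixed {n : ℕ} [NeZero n] {t : (sumZero n) ⊗[ℂ] (sumZero n)}
    (ht : t ∈ shiftFixed n) (i j : Fin n) :
    tensorCoord n i j t = tensorCoord n 0 (j - i) t := by
  have key : ∀ k : ℕ, ∀ i j : Fin n,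
      tensorCoord n (i - k • 1) (j - k • 1) t = tensorCoord n i j t := by
    intro k
    induction k with
    | zero => simp
    | succ k ih =>
      intro i j
      rw [succ_nsmul, ← sub_sub, ← sub_sub, mem_shiftFixed.mp ht, ih]
  have hi : (i : ℕ) • (1 : Fin n) = i := by
    open scoped Fin.CommRing in simp
  have := key i i j
  rwa [hi, sub_self, eq_comm] at this

/-- Sum-zero functions `g` on the cyclic group satisfying `g (-k) = ε * g k`. -/
def signedSumZero (n : ℕ) [NeZero n] (ε : ℂ) : Submodule ℂ (Fin n → ℂ) where
  carrier := {g | ∑ i, g i = 0 ∧ ∀ k, g (-k) = ε * g k}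
  add_mem' := by
    rintro a b ⟨ha, ha'⟩ ⟨hb, hb'⟩
    refine ⟨by simp [Finset.sum_add_distrib, ha, hb], fun k => ?_⟩
    simp only [Pi.add_apply, ha', hb', mul_add]
  zero_mem' := by simp
  smul_mem' := by
    rintro c x ⟨hx, hx'⟩
    refine ⟨by simp [← Finset.mul_sum, hx], fun k => ?_⟩
    simp only [Pi.smul_apply, smul_eq_mul, hx']
    ring

lemma mem_signedSumZero {n : ℕ} [NeZero n] {ε : ℂ} {g : Fin n → ℂ} :
    g ∈ signedSumZero n ε ↔ ∑ i, g i = 0 ∧ ∀ k, g (-k) = ε * g k := Iff.rfl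

/-- The tensor whose matrix is the circulant `(i, j) ↦ g (j - i)`, for `g` of sum zero. -/
def circulantTensor (n : ℕ) [NeZero n] (g : Fin n → ℂ) : (sumZero n) ⊗[ℂ] (sumZero n) :=
  ∑ i, ∑ j, g (j - i) • (projBasis n i ⊗ₜ[ℂ] projBasis n j)

lemma tensorCoord_circulantTensor {n : ℕ} [NeZero n] {g : Fin n → ℂ} (hg : ∑ i, g i = 0)
    (i j : Fin n) : tensorCoord n i j (circulantTensor n g) = g (j - i) := by
  have h₁ : ∀ i, ∑ j, g (j - i) = 0 := fun i => by
    rw [← hg]; exact Fintype.sum_equiv (Equiv.subRight i) _ _ (fun _ => rfl)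
  have h₂ : ∀ j, ∑ i, g (j - i) = 0 := fun j => by
    rw [← hg]; exact Fintype.sum_equiv (Equiv.subLeft j) _ _ (fun _ => rfl)
  have inner : ∀ a, ∑ b, g (b - a) * (((if i = a then 1 else 0) - (n : ℂ)⁻¹) *
      ((if j = b then 1 else 0) - (n : ℂ)⁻¹)) =
        g (j - a) * ((if i = a then 1 else 0) - (n : ℂ)⁻¹) := by
    intro a
    have : ∀ b, g (b - a) * (((if i = a then 1 else 0) - (n : ℂ)⁻¹) *
      ((if j = b then 1 else 0) - (n : ℂ)⁻¹)) = ((if i = a then 1 else 0) - (n : ℂ)⁻¹) *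
        ((if j = b then g (b - a) else 0) - g (b - a) * (n : ℂ)⁻¹) := by
      intro b; split_ifs <;> ring
    simp only [this, ← Finset.mul_sum, Finset.sum_sub_distrib, ← Finset.sum_mul, h₁]
    simp [mul_comm]
  simp only [circulantTensor, map_sum, map_smul, tensorCoord_tmul, projBasis, smul_eq_mul, inner]
  simp [mul_sub, Finset.sum_sub_distrib, ← Finset.sum_mul, h₂]

/-- The fixed tensors on which the swap acts by `ε` correspond to their first matrix rows. -/
lemma finrank_inf_shiftFixed {n : ℕ} [NeZero n] (ε : ℂ)
    (S : Submodule ℂ ((sumZero n) ⊗[ℂ] (sumZero n)))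
    (hS : ∀ t, t ∈ S ↔ swapMap n t = ε • t) :
    Module.finrank ℂ ↥(S ⊓ shiftFixed n) = Module.finrank ℂ (signedSumZero n ε) := by
  have hmem : ∀ t ∈ S ⊓ shiftFixed n,
      LinearMap.pi (tensorCoord n 0) t ∈ signedSumZero n ε := by
    rintro t ⟨h₁, h₂⟩
    refine ⟨sum_tensorCoord 0 t, fun k => ?_⟩
    simp only [LinearMap.pi_apply]
    have := tensorCoord_of_mem_shiftFixed h₂ k 0
    rw [zero_sub] at this
    rw [← this, ← tensorCoord_swapMap, (hS t).mp h₁, map_smul, smul_eq_mul]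
  refine (LinearEquiv.ofBijective
    ((LinearMap.pi (tensorCoord n 0)).restrict hmem) ⟨?_, ?_⟩).finrank_eq
  · rintro ⟨s, hs⟩ ⟨t, ht⟩ h
    have h' : ∀ k, tensorCoord n 0 k s = tensorCoord n 0 k t :=
      fun k => congrFun (congrArg Subtype.val h) k
    refine Subtype.ext (tensor_ext fun i j => ?_)
    rw [tensorCoord_of_mem_shiftFixed hs.2, tensorCoord_of_mem_shiftFixed ht.2, h']
  · rintro ⟨g, hg, hg'⟩
    refine ⟨⟨circulantTensor n g, (hS _).mpr (tensor_ext fun i j => ?_),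
      mem_shiftFixed.mpr fun i j => ?_⟩, Subtype.ext (funext fun k => ?_)⟩
    · rw [tensorCoord_swapMap, map_smul, tensorCoord_circulantTensor hg,
        tensorCoord_circulantTensor hg, ← neg_sub, hg', smul_eq_mul]
    · rw [tensorCoord_circulantTensor hg, tensorCoord_circulantTensor hg, sub_sub_sub_cancel_right]
    · exact (tensorCoord_circulantTensor hg 0 k).trans (by rw [sub_zero])

lemma finrank_signedSumZero_one (n : ℕ) [NeZero n] :
    Module.finrank ℂ (signedSumZero n 1) = n / 2 := by
  have hn : 0 < n := NeZero.pos n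
  let r : Fin (n / 2) → Fin n := fun k => ⟨k + 1, by omega⟩
  let f : signedSumZero n 1 →ₗ[ℂ] (Fin (n / 2) → ℂ) :=
    LinearMap.funLeft ℂ ℂ r ∘ₗ (signedSumZero n 1).subtype
  have hf : Function.Bijective f := by
    constructor
    · rw [← LinearMap.ker_eq_bot, LinearMap.ker_eq_bot']
      rintro ⟨g, hg, hg'⟩ h
      have h0 : ∀ k : Fin (n / 2), g (r k) = 0 := fun k => congrFun h k
      have h1 : ∀ k : Fin n, k ≠ 0 → g k = 0 := by
        intro k hk
        have hk0 : (k : ℕ) ≠ 0 := fun h => hk (Fin.ext (by simpa using h))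
        by_cases hle : (k : ℕ) ≤ n / 2
        · rw [← h0 ⟨k - 1, by omega⟩]
          congr 1
          ext
          simp only [r]
          omega
        · have : -k = r ⟨n - k - 1, by omega⟩ := by
            ext
            simp only [r, Fin.val_neg, hk, if_false]
            omega
          rw [← one_mul (g k), ← hg', this, h0]
      have h2 : g 0 = 0 := by
        rw [← hg, Finset.sum_eq_single 0 (fun k _ hk => h1 k hk) (by simp)]
      refine Subtype.ext (funext fun k => ?_)
      by_cases hk : k = 0
      · exact hk ▸ h2
      · exact h1 k hk
    · intro h
      let u : Fin n → ℂ := fun k =>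
        if hk : (k : ℕ) = 0 then 0 else h ⟨min (k : ℕ) (n - k) - 1, by omega⟩
      have hu : ∀ k, u (-k) = u k := by
        intro k
        by_cases hk : k = 0
        · simp [hk]
        · have hk0 : (k : ℕ) ≠ 0 := fun h => hk (Fin.ext (by simpa using h))
          have hneg : ((-k : Fin n) : ℕ) = n - k := by simp [Fin.val_neg, hk]
          have : n - (k : ℕ) ≠ 0 := by omega
          simp only [u, hneg, hk0, this, dite_false]
          congr 2
          omega
      refine ⟨⟨u - Pi.single 0 (∑ i, u i), by simp [Finset.sum_sub_distrib], fun k => ?_⟩,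
        funext fun k => ?_⟩
      · simp [hu, Pi.single_apply]
      · have : r k ≠ 0 := fun h => by simpa [r] using congrArg Fin.val h
        change u (r k) - Pi.single (M := fun _ => ℂ) 0 _ (r k) = h k
        rw [Pi.single_eq_of_ne this, sub_zero]
        simp only [u, r, Nat.add_eq_zero_iff, one_ne_zero, and_false, dite_false]
        congr 1
        ext
        simp only
        omega
  rw [(LinearEquiv.ofBijective f hf).finrank_eq, Module.finrank_fin_fun]

lemma finrank_signedSumZero_neg_one (n : ℕ) [NeZero n] :
    Module.finrank ℂ (signedSumZero n (-1)) = (n - 1) / 2 := by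
  have hn : 0 < n := NeZero.pos n
  let r : Fin ((n - 1) / 2) → Fin n := fun k => ⟨k + 1, by omega⟩
  let f : signedSumZero n (-1) →ₗ[ℂ] (Fin ((n - 1) / 2) → ℂ) :=
    LinearMap.funLeft ℂ ℂ r ∘ₗ (signedSumZero n (-1)).subtype
  have hf : Function.Bijective f := by
    constructor
    · rw [← LinearMap.ker_eq_bot, LinearMap.ker_eq_bot']
      rintro ⟨g, hg, hg'⟩ h
      have h0 : ∀ k : Fin ((n - 1) / 2), g (r k) = 0 := fun k => congrFun h k
      have hfix : ∀ k, -k = k → g k = 0 := by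
        intro k hk
        have := hg' k
        rw [hk] at this
        linear_combination this / 2
      refine Subtype.ext (funext fun k => ?_)
      change g k = 0
      by_cases hk : k = 0
      · exact hfix k (by simp [hk])
      have hk0 : (k : ℕ) ≠ 0 := fun h => hk (Fin.ext (by simpa using h))
      have hneg : ((-k : Fin n) : ℕ) = n - k := by simp [Fin.val_neg, hk]
      rcases lt_trichotomy (2 * (k : ℕ)) n with hlt | heq | hgt
      · rw [← h0 ⟨k - 1, by omega⟩]
        congr 1
        ext
        simp only [r]
        omega
      · exact hfix k (Fin.ext (by omega))
      · have : -k = r ⟨n - k - 1, by omega⟩ := by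
          ext
          simp only [r, hneg]
          omega
        have := (hg' k).symm.trans (this ▸ h0 _)
        linear_combination -this
    · intro h
      let u : Fin n → ℂ := fun k =>
        if hk : (k : ℕ) ≠ 0 ∧ 2 * (k : ℕ) < n then h ⟨k - 1, by omega⟩ else 0
      let w : Fin n → ℂ := fun k => u k - u (-k)
      have hw : ∀ k, w (-k) = -1 * w k := fun k => by simp [w]
      refine ⟨⟨w, ?_, hw⟩, funext fun k => ?_⟩
      · simp only [w, Finset.sum_sub_distrib]
        rw [sub_eq_zero]
        exact Fintype.sum_equiv (Equiv.neg _) _ _ (fun k => by simp)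
      · have hr : r k ≠ 0 := fun h => by simpa [r] using congrArg Fin.val h
        have hrk : (r k : ℕ) = k + 1 := rfl
        have hneg : ((-r k : Fin n) : ℕ) = n - (k + 1) := by simp [Fin.val_neg, hr, hrk]
        have h1 : u (-r k) = 0 := dif_neg (by omega)
        have h2 : u (r k) = h k := dif_pos (by omega)
        change u (r k) - u (-r k) = h k
        rw [h1, h2, sub_zero]
  rw [(LinearEquiv.ofBijective f hf).finrank_eq, Module.finrank_fin_fun]

lemma finrank_symTwo_inf_shiftFixed (n : ℕ) [NeZero n] :
    Module.finrank ℂ ↥(symTwo n ⊓ shiftFixed n) = n / 2 := by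
  rw [finrank_inf_shiftFixed 1 _ fun t => ?_, finrank_signedSumZero_one]
  rw [symTwo, LinearMap.mem_ker, LinearMap.sub_apply, sub_eq_zero, LinearMap.id_apply, one_smul]

lemma finrank_altTwo_inf_shiftFixed (n : ℕ) [NeZero n] :
    Module.finrank ℂ ↥(altTwo n ⊓ shiftFixed n) = (n - 1) / 2 := by
  rw [finrank_inf_shiftFixed (-1) _ fun t => ?_, finrank_signedSumZero_neg_one]
  rw [altTwo, LinearMap.mem_ker, LinearMap.add_apply, add_eq_zero_iff_eq_neg, LinearMap.id_apply,
    neg_one_smul]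

/-- Let `V ⊂ ℂ^n` be the sum-zero hyperplane and `c` the cyclic
coordinate shift.  The fixed subspace of the map induced by `c` on `Sym² V` has
dimension `(n−1)/2` for odd `n` and `n/2` for even `n`, and the fixed subspace of the
map induced by `c` on `Λ² V` has dimension `(n−1)/2` for odd `n` and `n/2 − 1` for
even `n`. -/
theorem cyclic_shift_fixed_dims (n : ℕ) [NeZero n] :
    (Odd n →
      Module.finrank ℂ ↥(symTwo n ⊓ shiftFixed n) = (n - 1) / 2 ∧
      Module.finrank ℂ ↥(altTwo n ⊓ shiftFixed n) = (n - 1) / 2) ∧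
    (Even n →
      Module.finrank ℂ ↥(symTwo n ⊓ shiftFixed n) = n / 2 ∧
      Module.finrank ℂ ↥(altTwo n ⊓ shiftFixed n) = n / 2 - 1) := by
  rw [finrank_symTwo_inf_shiftFixed, finrank_altTwo_inf_shiftFixed]
  refine ⟨?_, ?_⟩
  · rintro ⟨k, rfl⟩
    omega
  · rintro ⟨k, rfl⟩
    omega
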